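/- For every ν>0 there exists T_{φ,ψ}>0 such that every optimal trajectory on [0,T] with |(x₁,y₁)| ≥ 8√π and T ≥ T_{φ,ψ}, equipped with PMP adjoint data (ρ, φ̂, p₃, p₄), satisfies ρ ≥ 1−ν. -/

import Mathlib

open MeasureTheory Real Set

noncomputable section

/-- Distance between two angles, computed modulo `2π`, with values in `[0, π]`. -/
def angleDist (a b : ℝ) : ℝ := ‖((a - b : ℝ) : Real.Angle)‖

/-- Hypothesis (H1): `φ` and `ψ` are nonnegative, `C²`, even, nondecreasing on `[0,∞)`,
and vanish at `0`. -/
def H1 (φ ψ : ℝ → ℝ) : Prop :=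
  (∀ r, 0 ≤ φ r) ∧ (∀ r, 0 ≤ ψ r) ∧
  ContDiff ℝ 2 φ ∧ ContDiff ℝ 2 ψ ∧
  (∀ r, φ (-r) = φ r) ∧ (∀ r, ψ (-r) = ψ r) ∧
  MonotoneOn φ (Set.Ici 0) ∧ MonotoneOn ψ (Set.Ici 0) ∧
  φ 0 = 0 ∧ ψ 0 = 0

/-- Hypothesis (H2): `ψ` is strictly convex with `ψ''(0) > 0`. -/
def H2 (ψ : ℝ → ℝ) : Prop :=
  StrictConvexOn ℝ Set.univ ψ ∧ 0 < iteratedDeriv 2 ψ 0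

/-- Hypothesis (H3): superlinear growth `ψ(r) ≥ C₀ |r|^p` for `|r| ≥ R₀`. -/
def H3 (ψ : ℝ → ℝ) (p C₀ R₀ : ℝ) : Prop :=
  1 < p ∧ 0 < C₀ ∧ 0 < R₀ ∧ ∀ r : ℝ, R₀ ≤ |r| → C₀ * |r| ^ p ≤ ψ r

/-- An admissible trajectory of the control system `x' = cos θ`, `y' = sin θ`,
`θ' = κ`, `κ' = u` on `[0, T]` steering `W₀` to `W₁`, with control `u ∈ L^p`;
the final angle is prescribed modulo `2π`. -/
def Connects (p : ℝ) (x y θ κ u : ℝ → ℝ) (T : ℝ)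
    (W₀ W₁ : ℝ × ℝ × ℝ × ℝ) : Prop :=
  0 < T ∧ Measurable u ∧
  IntegrableOn (fun t => |u t| ^ p) (Set.Icc 0 T) ∧
  x 0 = W₀.1 ∧ y 0 = W₀.2.1 ∧ θ 0 = W₀.2.2.1 ∧ κ 0 = W₀.2.2.2 ∧
  (∀ t ∈ Set.Icc (0:ℝ) T, x t = x 0 + ∫ s in (0:ℝ)..t, Real.cos (θ s)) ∧
  (∀ t ∈ Set.Icc (0:ℝ) T, y t = y 0 + ∫ s in (0:ℝ)..t, Real.sin (θ s)) ∧
  (∀ t ∈ Set.Icc (0:ℝ) T, θ t = θ 0 + ∫ s in (0:ℝ)..t, κ s) ∧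
  (∀ t ∈ Set.Icc (0:ℝ) T, κ t = κ 0 + ∫ s in (0:ℝ)..t, u s) ∧
  x T = W₁.1 ∧ y T = W₁.2.1 ∧ (∃ k : ℤ, θ T = W₁.2.2.1 + 2 * π * (k : ℝ)) ∧
  κ T = W₁.2.2.2

/-- The cost `C(u,T) = ∫₀ᵀ (1 + φ(κ(t)) + ψ(u(t))) dt`. -/
def cost (φ ψ κ u : ℝ → ℝ) (T : ℝ) : ℝ :=
  ∫ t in (0:ℝ)..T, (1 + φ (κ t) + ψ (u t))

/-- Optimality: the trajectory is admissible and minimizes the cost among all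
admissible trajectories steering `W₀` to `W₁`, over all final times. -/
def IsOptimal (φ ψ : ℝ → ℝ) (p : ℝ) (x y θ κ u : ℝ → ℝ) (T : ℝ)
    (W₀ W₁ : ℝ × ℝ × ℝ × ℝ) : Prop :=
  Connects p x y θ κ u T W₀ W₁ ∧
  ∀ x' y' θ' κ' u' : ℝ → ℝ, ∀ T' : ℝ, Connects p x' y' θ' κ' u' T' W₀ W₁ →
    cost φ ψ κ u T ≤ cost φ ψ κ' u' T'

/-- The initial point `X₀ = (0, 0, π/2, 0)`. -/
def Xinit : ℝ × ℝ × ℝ × ℝ := (0, 0, π/2, 0)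

/-- The constant `C_{φ,ψ} = 8√π (2 + ψ(1) + sup_{s∈[0,√(5π)]} φ(s))`. -/
def Cconst (φ ψ : ℝ → ℝ) : ℝ :=
  8 * Real.sqrt π * (2 + ψ 1 + sSup (φ '' Set.Icc 0 (Real.sqrt (5*π))))

/-- PMP adjoint data `(ρ, φ̂, p₃, p₄)` along a trajectory. -/
def PMPData (φ ψ : ℝ → ℝ) (θ κ u : ℝ → ℝ) (T ρ φh : ℝ) (p₃ p₄ : ℝ → ℝ) : Prop :=
  0 < ρ ∧ φh ∈ Set.Ico 0 (2*π) ∧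
  (∀ t ∈ Set.Icc (0:ℝ) T, p₃ t = p₃ 0 + ∫ s in (0:ℝ)..t, ρ * Real.sin (θ s - φh)) ∧
  (∀ t ∈ Set.Icc (0:ℝ) T, p₄ t = p₄ 0 + ∫ s in (0:ℝ)..t, (-(p₃ s) + deriv φ (κ s))) ∧
  (∀ᵐ t ∂(volume.restrict (Set.Icc (0:ℝ) T)), deriv ψ (u t) = p₄ t) ∧
  (∀ᵐ t ∂(volume.restrict (Set.Icc (0:ℝ) T)),
    ρ * Real.cos (θ t - φh) + p₃ t * κ t + p₄ t * u t
      - (1 + φ (κ t) + ψ (u t)) = 0)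

/-- `AnglePath φ ψ T a b X Y c`: some `C²` angle function, equal to `a` before time `0` and to `b`
after time `T`, produces the displacement `(X, Y)` over `[0, T]` at running cost at most `c`. -/
def AnglePath (φ ψ : ℝ → ℝ) (T a b X Y c : ℝ) : Prop :=
  0 ≤ T ∧ ∃ θ : ℝ → ℝ, ContDiff ℝ 2 θ ∧ (∀ t ≤ 0, θ t = a) ∧ (∀ t, T ≤ t → θ t = b) ∧
    (∫ t in (0:ℝ)..T, Real.cos (θ t)) = X ∧ (∫ t in (0:ℝ)..T, Real.sin (θ t)) = Y ∧
    (∫ t in (0:ℝ)..T, (φ (deriv θ t) + ψ (deriv (deriv θ) t))) ≤ c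

lemma deriv_eq_zero_of_const_Iic {f : ℝ → ℝ} (hf : Differentiable ℝ f) {c a : ℝ}
    (h : ∀ t ≤ c, f t = a) : ∀ t ≤ c, deriv f t = 0 := by
  intro t ht
  refine (uniqueDiffOn_Iic t t self_mem_Iic).eq_deriv _ (hf t).hasDerivAt.hasDerivWithinAt ?_
  refine (hasDerivWithinAt_const t (Iic t) a).congr (fun s hs => h s (le_trans hs ht)) (h t ht)

lemma deriv_eq_zero_of_const_Ici {f : ℝ → ℝ} (hf : Differentiable ℝ f) {c a : ℝ}
    (h : ∀ t, c ≤ t → f t = a) : ∀ t, c ≤ t → deriv f t = 0 := by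
  intro t ht
  refine (uniqueDiffOn_Ici t t self_mem_Ici).eq_deriv _ (hf t).hasDerivAt.hasDerivWithinAt ?_
  refine (hasDerivWithinAt_const t (Ici t) a).congr (fun s hs => h s (le_trans ht hs)) (h t ht)

lemma ContDiff.deriv_one {f : ℝ → ℝ} (hf : ContDiff ℝ 2 f) : ContDiff ℝ 1 (deriv f) :=
  ContDiff.deriv' (n := 1) (by simpa [one_add_one_eq_two] using hf)

lemma ContDiff.continuous_deriv_deriv {f : ℝ → ℝ} (hf : ContDiff ℝ 2 f) :
    Continuous (deriv (deriv f)) :=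
  hf.deriv_one.continuous_deriv le_rfl

lemma anglePath_straight {φ ψ : ℝ → ℝ} (hφ0 : φ 0 = 0) (hψ0 : ψ 0 = 0) (a : ℝ) {l : ℝ}
    (hl : 0 ≤ l) : AnglePath φ ψ l a a (l * Real.cos a) (l * Real.sin a) 0 := by
  refine ⟨hl, fun _ => a, contDiff_const, fun _ _ => rfl, fun _ _ => rfl, ?_, ?_, ?_⟩ <;>
    simp [hφ0, hψ0]

lemma anglePath_turn {φ ψ : ℝ → ℝ} (hφ : Continuous φ) (hψ : Continuous ψ) (L : ℝ) :
    ∃ M, ∀ a b, |b - a| ≤ L → ∃ X Y, |X| ≤ 1 ∧ |Y| ≤ 1 ∧ AnglePath φ ψ 1 a b X Y M := by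
  set S := Real.smoothTransition with hS
  have hSc : ContDiff ℝ 2 S := Real.smoothTransition.contDiff (n := 2)
  have c1 : Continuous (deriv S) := hSc.deriv_one.continuous
  have c2 : Continuous (deriv (deriv S)) := hSc.continuous_deriv_deriv
  have hcont : Continuous (fun q : ℝ × ℝ =>
      φ (q.1 * deriv S q.2) + ψ (q.1 * deriv (deriv S) q.2)) := by fun_prop
  obtain ⟨M, hM⟩ := (isCompact_Icc.prod isCompact_Icc :
    IsCompact (Icc (-L) L ×ˢ Icc (0:ℝ) 1)).exists_bound_of_continuousOn hcont.continuousOn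
  refine ⟨M, fun a b hab => ⟨_, _, ?_, ?_, zero_le_one, fun t => a + (b - a) * S t,
    by fun_prop, ?_, ?_, rfl, rfl, ?_⟩⟩
  · simpa using intervalIntegral.norm_integral_le_of_norm_le_const (a := (0:ℝ)) (b := 1) (C := 1)
      (f := fun t => Real.cos (a + (b - a) * S t)) (fun t _ => Real.abs_cos_le_one _)
  · simpa using intervalIntegral.norm_integral_le_of_norm_le_const (a := (0:ℝ)) (b := 1) (C := 1)
      (f := fun t => Real.sin (a + (b - a) * S t)) (fun t _ => Real.abs_sin_le_one _)
  · intro t ht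
    simp [hS, Real.smoothTransition.zero_of_nonpos ht]
  · intro t ht
    simp [hS, Real.smoothTransition.one_of_one_le ht]
  · have d1 : deriv (fun t => a + (b - a) * S t) = fun t => (b - a) * deriv S t := by
      funext t
      rw [deriv_const_add, deriv_const_mul_field]
    have d2 : deriv (fun t => (b - a) * deriv S t) = fun t => (b - a) * deriv (deriv S) t := by
      funext t
      rw [deriv_const_mul_field]
    rw [d1, d2]
    refine (le_abs_self _).trans ?_
    have := intervalIntegral.norm_integral_le_of_norm_le_const (a := (0:ℝ)) (b := 1) (C := M)
      (f := fun t => φ ((b - a) * deriv S t) + ψ ((b - a) * deriv (deriv S) t)) (fun t ht => ?_)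
    · simpa using this
    · rw [uIoc_of_le zero_le_one] at ht
      exact hM (b - a, t) ⟨abs_le.1 hab, ⟨ht.1.le, ht.2⟩⟩

lemma AnglePath.trans {φ ψ : ℝ → ℝ} (hφ : Continuous φ) (hψ : Continuous ψ)
    {T a b X Y k T' b' X' Y' k' : ℝ} (h : AnglePath φ ψ T a b X Y k)
    (h' : AnglePath φ ψ T' b b' X' Y' k') :
    AnglePath φ ψ (T + T') a b' (X + X') (Y + Y') (k + k') := by
  obtain ⟨hT, f, hf, f0, fT, fX, fY, fc⟩ := h
  obtain ⟨hT', g, hg, g0, gT, gX, gY, gc⟩ := h'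
  set θ : ℝ → ℝ := fun t => f t + g (t - T) - b with hθ
  have hθv : ∀ t, θ t = f t + g (t - T) - b := fun t => rfl
  have hθc : ContDiff ℝ 2 θ := by fun_prop
  have d1 : deriv θ = fun t => deriv f t + deriv g (t - T) := by
    funext t
    have h1 := (hf.differentiable (by norm_num) t).hasDerivAt
    have h2 := ((hg.differentiable (by norm_num) (t - T)).hasDerivAt).comp_sub_const t T
    exact ((h1.add h2).sub_const b).deriv
  have d2 : deriv (deriv θ) = fun t => deriv (deriv f) t + deriv (deriv g) (t - T) := by
    funext t
    have h1 := (hf.deriv_one.differentiable (by norm_num) t).hasDerivAt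
    have h2 := ((hg.deriv_one.differentiable (by norm_num) (t - T)).hasDerivAt).comp_sub_const t T
    rw [d1]
    exact (h1.add h2).deriv
  have d1v := congrFun d1
  have d2v := congrFun d2
  clear_value θ
  have df := deriv_eq_zero_of_const_Ici (hf.differentiable (by norm_num)) fT
  have ddf := deriv_eq_zero_of_const_Ici (hf.deriv_one.differentiable (by norm_num)) df
  have dg := deriv_eq_zero_of_const_Iic (hg.differentiable (by norm_num)) g0
  have ddg := deriv_eq_zero_of_const_Iic (hg.deriv_one.differentiable (by norm_num)) dg
  have key : ∀ F : ℝ → ℝ → ℝ → ℝ, (Continuous fun q : ℝ × ℝ × ℝ => F q.1 q.2.1 q.2.2) →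
      (∫ t in (0:ℝ)..(T + T'), F (θ t) (deriv θ t) (deriv (deriv θ) t))
        = (∫ t in (0:ℝ)..T, F (f t) (deriv f t) (deriv (deriv f) t))
          + ∫ t in (0:ℝ)..T', F (g t) (deriv g t) (deriv (deriv g) t) := by
    intro F hF
    have hc : Continuous fun t => F (θ t) (deriv θ t) (deriv (deriv θ) t) :=
      hF.comp (hθc.continuous.prodMk
        (hθc.deriv_one.continuous.prodMk hθc.continuous_deriv_deriv))
    rw [← intervalIntegral.integral_add_adjacent_intervals (b := T)
      (hc.intervalIntegrable _ _) (hc.intervalIntegrable _ _)]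
    congr 1
    · refine intervalIntegral.integral_congr fun t ht => ?_
      rw [uIcc_of_le hT] at ht
      have : t - T ≤ 0 := sub_nonpos.2 ht.2
      simp only [d2v, d1v, dg _ this, ddg _ this, hθv, g0 _ this]
      simp
    · have := intervalIntegral.integral_comp_sub_right (a := T) (b := T + T')
        (fun t => F (g t) (deriv g t) (deriv (deriv g) t)) T
      rw [sub_self, add_sub_cancel_left] at this
      rw [← this]
      refine intervalIntegral.integral_congr fun t ht => ?_
      rw [uIcc_of_le (by linarith)] at ht
      simp only [d2v, d1v, df _ ht.1, ddf _ ht.1, hθv, fT _ ht.1]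
      simp
  refine ⟨by linarith, θ, hθc, ?_, ?_, ?_, ?_, ?_⟩
  · intro t ht
    simp [hθv, f0 t ht, g0 (t - T) (by linarith)]
  · intro t ht
    simp [hθv, fT t (by linarith), gT (t - T) (by linarith)]
  · rw [key (fun r _ _ => Real.cos r) (by fun_prop), fX, gX]
  · rw [key (fun r _ _ => Real.sin r) (by fun_prop), fY, gY]
  · rw [key (fun _ r s => φ r + ψ s) (by fun_prop)]
    linarith

lemma exists_angle_congr (b θ : ℝ) : ∃ k : ℤ, |θ + 2 * π * (k : ℝ) - b| ≤ 2 * π := by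
  refine ⟨⌊(b - θ) / (2 * π)⌋, ?_⟩
  have hp : 0 < 2 * π := by positivity
  have h1 := Int.floor_le ((b - θ) / (2 * π))
  have h2 := Int.lt_floor_add_one ((b - θ) / (2 * π))
  rw [le_div_iff₀ hp] at h1
  rw [div_lt_iff₀ hp] at h2
  rw [abs_le]
  constructor <;> nlinarith

lemma exists_polar (x y : ℝ) : ∃ α : ℝ, |α| ≤ π ∧
    x = Real.sqrt (x ^ 2 + y ^ 2) * Real.cos α ∧ y = Real.sqrt (x ^ 2 + y ^ 2) * Real.sin α := by
  refine ⟨Complex.arg ⟨x, y⟩, Complex.abs_arg_le_pi _, ?_⟩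
  have hn : ‖(⟨x, y⟩ : ℂ)‖ = Real.sqrt (x ^ 2 + y ^ 2) := by
    rw [Complex.norm_eq_sqrt_sq_add_sq]
  rw [← hn, Complex.norm_mul_cos_arg, Complex.norm_mul_sin_arg]
  exact ⟨rfl, rfl⟩

lemma anglePath_exists {φ ψ : ℝ → ℝ} (hφ : Continuous φ) (hψ : Continuous ψ)
    (hφ0 : φ 0 = 0) (hψ0 : ψ 0 = 0) :
    ∃ C, ∀ x y θ₁ : ℝ, ∃ T c : ℝ, ∃ k : ℤ, 0 < T ∧
      T + c ≤ Real.sqrt (x ^ 2 + y ^ 2) + C ∧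
      AnglePath φ ψ T (π / 2) (θ₁ + 2 * π * (k : ℝ)) x y c := by
  obtain ⟨M, hM⟩ := anglePath_turn hφ hψ (3 * π)
  refine ⟨15 + 5 * M, fun x y θ₁ => ?_⟩
  have hpi := Real.pi_pos
  obtain ⟨α, hα, hx, hy⟩ := exists_polar x y
  set R := Real.sqrt (x ^ 2 + y ^ 2)
  have hR : 0 ≤ R := Real.sqrt_nonneg _
  obtain ⟨k, hk⟩ := exists_angle_congr α θ₁
  obtain ⟨X1, Y1, hX1, hY1, p1⟩ := hM (π / 2) π (by rw [abs_le]; constructor <;> linarith)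
  obtain ⟨X2, Y2, hX2, hY2, p2⟩ := hM π (π / 2 + π) (by rw [abs_le]; constructor <;> linarith)
  obtain ⟨X3, Y3, hX3, hY3, p3⟩ :=
    hM (π / 2 + π) (2 * π) (by rw [abs_le]; constructor <;> linarith)
  obtain ⟨X4, Y4, hX4, hY4, p4⟩ := hM (2 * π) α
    (by rw [abs_le] at hα ⊢; constructor <;> linarith)
  obtain ⟨X5, Y5, hX5, hY5, p5⟩ := hM α (θ₁ + 2 * π * (k : ℝ)) (hk.trans (by linarith))
  set P := -(X1 + X2 + X3 + X4 + X5) with hP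
  set Q := -(Y1 + Y2 + Y3 + Y4 + Y5) with hQ
  rw [abs_le] at hX1 hX2 hX3 hX4 hX5 hY1 hY2 hY3 hY4 hY5
  have hPQ : |P| + |Q| ≤ 10 := by
    have : |P| ≤ 5 := abs_le.2 ⟨by linarith, by linarith⟩
    have : |Q| ≤ 5 := abs_le.2 ⟨by linarith, by linarith⟩
    linarith
  have st := fun (a : ℝ) {l : ℝ} (hl : 0 ≤ l) =>
    anglePath_straight (φ := φ) (ψ := ψ) hφ0 hψ0 a hl
  have tot := ((((((((((st (π / 2) (le_max_right Q 0)).trans hφ hψ p1).trans hφ hψ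
    (st π (le_max_right (-P) 0))).trans hφ hψ p2).trans hφ hψ
    (st (π / 2 + π) (le_max_right (-Q) 0))).trans hφ hψ p3).trans hφ hψ
    (st (2 * π) (le_max_right P 0))).trans hφ hψ p4).trans hφ hψ
    (st α hR)).trans hφ hψ p5)
  have aP : max P 0 + max (-P) 0 = |P| := by
    rcases le_total P 0 with h | h
    · rw [max_eq_right h, max_eq_left (by linarith), abs_of_nonpos h, zero_add]
    · rw [max_eq_left h, max_eq_right (by linarith), abs_of_nonneg h, add_zero]
  have aQ : max Q 0 + max (-Q) 0 = |Q| := by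
    rcases le_total Q 0 with h | h
    · rw [max_eq_right h, max_eq_left (by linarith), abs_of_nonpos h, zero_add]
    · rw [max_eq_left h, max_eq_right (by linarith), abs_of_nonneg h, add_zero]
  have bP : max P 0 - max (-P) 0 = P := by
    rcases le_total P 0 with h | h
    · rw [max_eq_right h, max_eq_left (by linarith)]; ring
    · rw [max_eq_left h, max_eq_right (by linarith)]; ring
  have bQ : max Q 0 - max (-Q) 0 = Q := by
    rcases le_total Q 0 with h | h
    · rw [max_eq_right h, max_eq_left (by linarith)]; ring
    · rw [max_eq_left h, max_eq_right (by linarith)]; ring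
  have m1 := le_max_right Q 0
  have m2 := le_max_right (-Q) 0
  have m3 := le_max_right P 0
  have m4 := le_max_right (-P) 0
  simp only [Real.cos_pi_div_two, Real.sin_pi_div_two, Real.cos_pi, Real.sin_pi,
    Real.cos_add_pi, Real.sin_add_pi, Real.cos_two_pi, Real.sin_two_pi, ← hx, ← hy] at tot
  have eX : max Q 0 * 0 + X1 + max (-P) 0 * -1 + X2 + max (-Q) 0 * -0 + X3 + max P 0 * 1 + X4
      + x + X5 = x := by linarith
  have eY : max Q 0 * 1 + Y1 + max (-P) 0 * 0 + Y2 + max (-Q) 0 * -1 + Y3 + max P 0 * 0 + Y4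
      + y + Y5 = y := by linarith
  rw [eX, eY] at tot
  exact ⟨_, _, k, by linarith, by linarith, tot⟩

lemma AnglePath.connects {φ ψ : ℝ → ℝ} {p T a b X Y c θ₁ : ℝ} {k : ℤ} (hp : 0 ≤ p) (hT : 0 < T)
    (hb : b = θ₁ + 2 * π * (k : ℝ)) (hφ : Continuous φ) (hψ : Continuous ψ)
    (h : AnglePath φ ψ T a b X Y c) :
    ∃ x y θ κ u : ℝ → ℝ, Connects p x y θ κ u T (0, 0, a, 0) (X, Y, θ₁, 0) ∧
      cost φ ψ κ u T ≤ T + c := by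
  obtain ⟨-, θ, hθ, h0, h1, hX, hY, hc⟩ := h
  have c0 := hθ.continuous
  have c1 := hθ.deriv_one.continuous
  have c2 := hθ.continuous_deriv_deriv
  have dif := hθ.differentiable (by norm_num)
  have dif' := hθ.deriv_one.differentiable (by norm_num)
  have k0 : deriv θ 0 = 0 := deriv_eq_zero_of_const_Iic dif h0 0 le_rfl
  have kT : deriv θ T = 0 := deriv_eq_zero_of_const_Ici dif h1 T le_rfl
  refine ⟨fun t => ∫ s in (0:ℝ)..t, Real.cos (θ s), fun t => ∫ s in (0:ℝ)..t, Real.sin (θ s),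
    θ, deriv θ, deriv (deriv θ), ⟨hT, c2.measurable, ?_, by simp, by simp, h0 0 le_rfl, k0,
      fun t _ => by simp, fun t _ => by simp, ?_, ?_, hX, hY, ⟨k, by rw [h1 T le_rfl, hb]⟩, kT⟩, ?_⟩
  · exact (c2.abs.rpow_const fun _ => Or.inr hp).continuousOn.integrableOn_Icc
  · intro t _
    rw [intervalIntegral.integral_deriv_eq_sub (fun s _ => dif s) (c1.intervalIntegrable _ _)]
    ring
  · intro t _
    rw [intervalIntegral.integral_deriv_eq_sub (fun s _ => dif' s) (c2.intervalIntegrable _ _)]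
    ring
  · have e : cost φ ψ (deriv θ) (deriv (deriv θ)) T = (∫ _ in (0:ℝ)..T, (1:ℝ)) +
        ∫ t in (0:ℝ)..T, (φ (deriv θ t) + ψ (deriv (deriv θ) t)) := by
      rw [← intervalIntegral.integral_add (by simp)
        (Continuous.intervalIntegrable (by fun_prop) _ _)]
      simp only [cost, add_assoc]
    rw [e]
    simpa using hc

lemma ConvexOn.le_deriv_mul_self {ψ : ℝ → ℝ} (hψ : ConvexOn ℝ univ ψ) (hd : Differentiable ℝ ψ)
    (h0 : ψ 0 = 0) (r : ℝ) : ψ r ≤ deriv ψ r * r := by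
  rcases lt_trichotomy r 0 with h | h | h
  · have := hψ.deriv_le_slope (mem_univ r) (mem_univ 0) h (hd r)
    rw [slope_def_field, h0, le_div_iff₀ (by linarith)] at this
    linarith
  · simp [h, h0]
  · have := hψ.slope_le_deriv (mem_univ 0) (mem_univ r) h (hd r)
    rw [slope_def_field, h0, div_le_iff₀ (by linarith)] at this
    linarith

lemma StrictConvexOn.pos_of_nonneg {ψ : ℝ → ℝ} (hψ : StrictConvexOn ℝ univ ψ)
    (hnn : ∀ r, 0 ≤ ψ r) (h0 : ψ 0 = 0) {d : ℝ} (hd : d ≠ 0) : 0 < ψ d := by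
  have := hψ.2 (mem_univ 0) (mem_univ d) hd.symm (by norm_num : (0:ℝ) < 1 / 2)
    (by norm_num : (0:ℝ) < 1 / 2) (by norm_num)
  have h2 := hnn ((1 / 2 : ℝ) • (0:ℝ) + (1 / 2 : ℝ) • d)
  simp only [smul_eq_mul, h0] at this h2
  linarith

lemma ConvexOn.abs_le_add_mul {ψ : ℝ → ℝ} (hψ : ConvexOn ℝ univ ψ) (hnn : ∀ r, 0 ≤ ψ r)
    (heven : ∀ r, ψ (-r) = ψ r) (h0 : ψ 0 = 0) {d : ℝ} (hd : 0 < d) (hpos : 0 < ψ d) (r : ℝ) :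
    |r| ≤ d + d / ψ d * ψ r := by
  have hK : 0 ≤ d / ψ d * ψ r := mul_nonneg (div_pos hd hpos).le (hnn r)
  rcases le_or_gt |r| d with h | h
  · linarith
  · have hr : 0 < |r| := hd.trans h
    have e : ψ |r| = ψ r := by rcases abs_choice r with h | h <;> simp [h, heven]
    have := hψ.2 (mem_univ |r|) (mem_univ 0) (by positivity : 0 ≤ d / |r|)
      (by rw [sub_nonneg, div_le_one hr]; exact h.le : 0 ≤ 1 - d / |r|) (by ring)
    simp only [smul_eq_mul, h0, mul_zero, add_zero, e] at this
    rw [div_mul_cancel₀ _ hr.ne', div_mul_eq_mul_div, le_div_iff₀ hr] at this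
    have : |r| ≤ d / ψ d * ψ r := by
      rw [div_mul_eq_mul_div, le_div_iff₀ hpos]
      linarith
    linarith

section Primitive

variable {f F : ℝ → ℝ} {T : ℝ}

lemma continuousOn_of_primitive (hT : 0 ≤ T) (hf : IntegrableOn f (Icc 0 T))
    (hF : ∀ t ∈ Icc (0:ℝ) T, F t = F 0 + ∫ s in (0:ℝ)..t, f s) : ContinuousOn F (Icc 0 T) := by
  have := intervalIntegral.continuousOn_primitive_interval (a := 0) (b := T) (f := f) (μ := volume)
    (by rwa [uIcc_of_le hT])
  rw [uIcc_of_le hT] at this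
  exact (continuousOn_const.add this).congr hF

lemma intervalIntegrable_of_mem {a b : ℝ} (hf : IntegrableOn f (Icc 0 T)) (ha : a ∈ Icc 0 T)
    (hb : b ∈ Icc 0 T) : IntervalIntegrable f volume a b :=
  (hf.mono_set (uIcc_subset_Icc ha hb)).intervalIntegrable

lemma sub_eq_integral_of_primitive {a b : ℝ} (hf : IntegrableOn f (Icc 0 T))
    (hF : ∀ t ∈ Icc (0:ℝ) T, F t = F 0 + ∫ s in (0:ℝ)..t, f s) (ha : a ∈ Icc 0 T)
    (hb : b ∈ Icc 0 T) : F b - F a = ∫ s in a..b, f s := by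
  have h0 : (0:ℝ) ∈ Icc 0 T := ⟨le_rfl, ha.1.trans ha.2⟩
  rw [hF a ha, hF b hb, ← intervalIntegral.integral_interval_sub_left
    (intervalIntegrable_of_mem hf h0 hb) (intervalIntegrable_of_mem hf h0 ha)]
  ring

lemma hasDerivAt_of_primitive {t : ℝ} (hf : ContinuousOn f (Icc 0 T))
    (hF : ∀ t ∈ Icc (0:ℝ) T, F t = F 0 + ∫ s in (0:ℝ)..t, f s) (ht : t ∈ Ioo 0 T) :
    HasDerivAt F (f t) t := by
  have h0 : (0:ℝ) ∈ Icc 0 T := ⟨le_rfl, (ht.1.trans ht.2).le⟩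
  have hn : Icc 0 T ∈ nhds t := Icc_mem_nhds ht.1 ht.2
  have := intervalIntegral.integral_hasDerivAt_right (a := 0) (b := t) (f := f)
    (intervalIntegrable_of_mem hf.integrableOn_Icc h0 (Ioo_subset_Icc_self ht))
    ((hf.mono Ioo_subset_Icc_self).stronglyMeasurableAtFilter isOpen_Ioo t ht)
    (hf.continuousAt hn)
  refine (this.const_add (F 0)).congr_of_eventuallyEq ?_
  filter_upwards [hn] with s hs using hF s hs

end Primitive

lemma exists_window {g : ℝ → ℝ} {T C ε : ℝ} {N : ℕ} (hg : IntegrableOn g (Icc 0 T))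
    (hnn : ∀ t, 0 ≤ g t) (hC : ∫ t in (0:ℝ)..T, g t ≤ C) (hN : C < N * ε)
    (hT : 3 * (N : ℝ) ≤ T) : ∃ w, 0 ≤ w ∧ w + 3 ≤ T ∧ ∫ t in w..(w + 3), g t ≤ ε := by
  by_contra! hcon
  have key : ∀ n : ℕ, n ≤ N → n * ε ≤ ∫ t in (0:ℝ)..(3 * (n:ℝ)), g t := by
    intro n
    induction n with
    | zero => simp
    | succ n ih =>
      intro hn
      have hn' : (n:ℝ) + 1 ≤ N := by exact_mod_cast hn
      have hn0 : (0:ℝ) ≤ n := n.cast_nonneg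
      have h1 := ih (Nat.le_of_succ_le hn)
      have h2 := hcon (3 * n) (by positivity) (by linarith)
      push_cast
      have e : (3:ℝ) * (n + 1) = 3 * n + 3 := by ring
      have m0 : (0:ℝ) ∈ Icc 0 T := ⟨le_rfl, by linarith⟩
      have m1 : 3 * (n:ℝ) ∈ Icc 0 T := ⟨by linarith, by linarith⟩
      have m2 : 3 * (n:ℝ) + 3 ∈ Icc 0 T := ⟨by linarith, by linarith⟩
      rw [e, ← intervalIntegral.integral_add_adjacent_intervals
        (intervalIntegrable_of_mem hg m0 m1) (intervalIntegrable_of_mem hg m1 m2)]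
      linarith
  have h1 := key N le_rfl
  have hN0 : (0:ℝ) ≤ N := N.cast_nonneg
  have h2 := intervalIntegral.integral_mono_interval (μ := volume) (f := g) (a := 0)
    (b := 3 * N) (c := 0) (d := T) le_rfl (by positivity) hT (ae_of_all _ hnn)
    (intervalIntegrable_of_mem hg ⟨le_rfl, by linarith⟩ ⟨by linarith, le_rfl⟩)
  linarith

lemma exists_good_time {g : ℝ → ℝ} {P : ℝ → Prop} {T ε a : ℝ} (hg : IntegrableOn g (Icc 0 T))
    (hP : ∀ᵐ t ∂(volume.restrict (Icc (0:ℝ) T)), P t) (ha : 0 ≤ a) (haT : a + 1 ≤ T)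
    (hε : ∫ t in a..(a + 1), g t ≤ ε) : ∃ t ∈ Icc a (a + 1), g t ≤ ε ∧ P t := by
  have hsub : Ioc a (a + 1) ⊆ Icc 0 T := fun t ht => ⟨ha.trans ht.1.le, ht.2.trans haT⟩
  have : IsProbabilityMeasure (volume.restrict (Ioc a (a + 1))) :=
    ⟨by rw [Measure.restrict_apply_univ, Real.volume_Ioc]; simp⟩
  have hP' : ∀ᵐ t ∂(volume.restrict (Ioc a (a + 1))), t ∈ Ioc a (a + 1) ∧ P t :=
    (ae_restrict_mem measurableSet_Ioc).and (ae_restrict_of_ae_restrict_of_subset hsub hP)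
  obtain ⟨t, ht, htg⟩ := exists_notMem_null_le_integral (hg.mono_set hsub) (ae_iff.1 hP')
  simp only [mem_ofPred_eq, not_not] at ht
  rw [intervalIntegral.integral_of_le (by linarith)] at hε
  exact ⟨t, Ioc_subset_Icc_self ht.1, htg.trans hε, ht.2⟩

lemma abs_sin_le_of_one_sub_cos_le {r ε d : ℝ} (hd : 0 ≤ d) (h : 1 - Real.cos r ≤ ε)
    (hε : 2 * ε ≤ d ^ 2) : |Real.sin r| ≤ d := by
  refine abs_le_of_sq_le_sq ?_ hd
  nlinarith [Real.sin_sq_add_cos_sq r, Real.cos_le_one r, Real.neg_one_le_cos r]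

/-- On a stretch of unit length or more where the angle is close to `α` in mean, the curvature
varies little, and the angle is close to `α` (modulo `2π`) at both ends, the curvature is small. -/
lemma abs_curvature_le {θ κ : ℝ → ℝ} {a b α d ε : ℝ} (hab : a + 1 ≤ b) (hb : b ≤ a + 3)
    (hε : ε ≤ 1 / 2) (hθ : ContinuousOn θ (Icc a b)) (hκ : ContinuousOn κ (Icc a b))
    (hd : ∀ t ∈ Ioo a b, HasDerivAt θ (κ t) t)
    (hvar : ∀ t ∈ Icc a b, |κ t - κ a| ≤ 4 * d)
    (ha : |Real.sin (θ a - α)| ≤ d) (hb' : |Real.sin (θ b - α)| ≤ d)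
    (hI : ∫ t in a..b, (1 - Real.cos (θ t - α)) ≤ ε) : |κ a| ≤ 28 * d := by
  have hle : a ≤ b := by linarith
  have ccos : ContinuousOn (fun t => Real.cos (θ t - α)) (Icc a b) :=
    Real.continuous_cos.comp_continuousOn (hθ.sub continuousOn_const)
  have icos : IntervalIntegrable (fun t => Real.cos (θ t - α)) volume a b :=
    ccos.intervalIntegrable_of_Icc hle
  have icosκ : IntervalIntegrable (fun t => Real.cos (θ t - α) * κ t) volume a b :=
    (ccos.mul hκ).intervalIntegrable_of_Icc hle
  have h1 : ∫ t in a..b, Real.cos (θ t - α) * κ t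
      = Real.sin (θ b - α) - Real.sin (θ a - α) := by
    refine intervalIntegral.integral_eq_sub_of_hasDerivAt_of_le hle
      (f := fun t => Real.sin (θ t - α))
      (Real.continuous_sin.comp_continuousOn (hθ.sub continuousOn_const)) ?_ icosκ
    intro t ht
    exact ((hd t ht).sub_const α).sin
  have h2 : |∫ t in a..b, Real.cos (θ t - α) * (κ t - κ a)| ≤ 4 * d * |b - a| := by
    rw [← Real.norm_eq_abs]
    refine intervalIntegral.norm_integral_le_of_norm_le_const fun t ht => ?_
    rw [uIoc_of_le hle] at ht
    rw [Real.norm_eq_abs, abs_mul]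
    calc |Real.cos (θ t - α)| * |κ t - κ a| ≤ 1 * |κ t - κ a| :=
          mul_le_mul_of_nonneg_right (Real.abs_cos_le_one _) (abs_nonneg _)
      _ ≤ 4 * d := by rw [one_mul]; exact hvar t (Ioc_subset_Icc_self ht)
  have h3 : ∫ t in a..b, Real.cos (θ t - α) * (κ t - κ a)
      = (∫ t in a..b, Real.cos (θ t - α) * κ t) - (∫ t in a..b, Real.cos (θ t - α)) * κ a := by
    rw [← intervalIntegral.integral_mul_const, ← intervalIntegral.integral_sub
      icosκ (icos.mul_const _)]
    simp only [mul_sub]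
  have h4 : 1 / 2 ≤ ∫ t in a..b, Real.cos (θ t - α) := by
    rw [intervalIntegral.integral_sub (by simp) icos] at hI
    simp only [intervalIntegral.integral_const, smul_eq_mul, mul_one] at hI
    linarith
  rw [abs_of_nonneg (by linarith : 0 ≤ b - a)] at h2
  have hd0 : 0 ≤ d := (abs_nonneg _).trans ha
  have h5 : 4 * d * (b - a) ≤ 12 * d := by nlinarith
  set I := ∫ t in a..b, Real.cos (θ t - α)
  have h6 : |I * κ a| ≤ 14 * d := by
    rw [h3, h1] at h2
    rw [abs_le] at *
    constructor <;> linarith [ha.1, ha.2, hb'.1, hb'.2, h2.1, h2.2]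
  rw [abs_mul, abs_of_nonneg (by linarith : 0 ≤ I)] at h6
  nlinarith [abs_nonneg (κ a)]

/-- A `1`-Lipschitz function whose integral over a stretch of length at least `1` is
bounded is itself bounded. -/
lemma abs_le_of_abs_integral_le {q : ℝ → ℝ} {a b : ℝ} (hab : a + 1 ≤ b)
    (hq : ContinuousOn q (Icc a b)) (hlip : ∀ t ∈ Icc a b, |q t - q a| ≤ 3)
    (hI : |∫ t in a..b, q t| ≤ 2 + (b - a)) : |q a| ≤ 6 := by
  have hle : a ≤ b := by linarith
  have h2 : |∫ t in a..b, (q t - q a)| ≤ 3 * |b - a| := by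
    rw [← Real.norm_eq_abs]
    refine intervalIntegral.norm_integral_le_of_norm_le_const fun t ht => ?_
    rw [uIoc_of_le hle] at ht
    exact hlip t (Ioc_subset_Icc_self ht)
  rw [intervalIntegral.integral_sub (hq.intervalIntegrable_of_Icc hle) (by simp),
    intervalIntegral.integral_const, smul_eq_mul, abs_of_nonneg (by linarith : 0 ≤ b - a)] at h2
  have h3 : (b - a) * |q a| ≤ 2 + 4 * (b - a) := by
    rw [← abs_of_nonneg (by linarith : 0 ≤ b - a), ← abs_mul,
      abs_of_nonneg (by linarith : 0 ≤ b - a)]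
    rw [abs_le] at *
    constructor <;> linarith [h2.1, h2.2, hI.1, hI.2]
  nlinarith [abs_nonneg (q a)]

lemma exists_abs_deriv_le_one {f : ℝ → ℝ} (hf : ContDiff ℝ 2 f) (hnn : ∀ r, 0 ≤ f r)
    (h0 : f 0 = 0) : ∃ η > 0, ∀ r, |r| ≤ η → |deriv f r| ≤ 1 := by
  have hd : deriv f 0 = 0 :=
    IsLocalMin.deriv_eq_zero (Filter.Eventually.of_forall fun r => by rw [h0]; exact hnn r)
  have hc : ContinuousAt (deriv f) 0 := hf.deriv_one.continuous.continuousAt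
  obtain ⟨η, hη, h⟩ := Metric.continuousAt_iff.1 hc 1 one_pos
  refine ⟨η / 2, by positivity, fun r hr => ?_⟩
  have := h (x := r) (by rw [Real.dist_eq, sub_zero]; linarith)
  rw [hd, Real.dist_eq, sub_zero] at this
  exact this.le

lemma integrableOn_of_rpow {u : ℝ → ℝ} {p T : ℝ} (hp : 1 < p) (hu : Measurable u)
    (hup : IntegrableOn (fun t => |u t| ^ p) (Icc 0 T)) : IntegrableOn u (Icc 0 T) := by
  refine Integrable.mono' (g := fun t => 1 + |u t| ^ p)
    ((integrableOn_const (by simp)).add hup) hu.aestronglyMeasurable (ae_of_all _ fun t => ?_)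
  rw [Real.norm_eq_abs]
  have h0 : 0 ≤ |u t| ^ p := Real.rpow_nonneg (abs_nonneg _) _
  rcases le_total |u t| 1 with h | h
  · linarith
  · have := Real.self_le_rpow_of_one_le h hp.le
    linarith

/-- The cost density is integrable as soon as `ψ'(u)` agrees a.e. with a bounded function. -/
lemma integrableOn_comp_of_deriv_eq {ψ u q : ℝ → ℝ} {T : ℝ} (hψ : ConvexOn ℝ univ ψ)
    (hψd : ContDiff ℝ 2 ψ) (hnn : ∀ r, 0 ≤ ψ r) (h0 : ψ 0 = 0) (hum : Measurable u)
    (hu : IntegrableOn u (Icc 0 T)) (hq : ContinuousOn q (Icc 0 T))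
    (h : ∀ᵐ t ∂(volume.restrict (Icc (0:ℝ) T)), deriv ψ (u t) = q t) :
    IntegrableOn (fun t => ψ (u t)) (Icc 0 T) := by
  obtain ⟨M, hM⟩ := isCompact_Icc.exists_bound_of_continuousOn hq
  refine Integrable.mono' (hu.abs.const_mul M)
    (hψd.continuous.measurable.comp hum).aestronglyMeasurable ?_
  filter_upwards [h, ae_restrict_mem measurableSet_Icc] with t ht htm
  rw [Real.norm_eq_abs, abs_of_nonneg (hnn _)]
  calc ψ (u t) ≤ deriv ψ (u t) * u t :=
        hψ.le_deriv_mul_self (hψd.differentiable (by norm_num)) h0 _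
    _ ≤ |deriv ψ (u t) * u t| := le_abs_self _
    _ ≤ M * |u t| := by
        rw [abs_mul, ht]
        exact mul_le_mul_of_nonneg_right (hM t htm) (abs_nonneg _)

/-- The excess density: running cost minus progress in the direction `α`. -/
def excess (φ ψ θ κ u : ℝ → ℝ) (α t : ℝ) : ℝ :=
  φ (κ t) + ψ (u t) + (1 - Real.cos (θ t - α))

lemma integral_excess_le {φ ψ θ κ u : ℝ → ℝ} {T α R C x y : ℝ} (hT : 0 < T)
    (hφ : Continuous φ) (hκ : ContinuousOn κ (Icc 0 T)) (hθ : ContinuousOn θ (Icc 0 T))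
    (hψ : IntegrableOn (fun t => ψ (u t)) (Icc 0 T))
    (hx : x = ∫ t in (0:ℝ)..T, Real.cos (θ t)) (hy : y = ∫ t in (0:ℝ)..T, Real.sin (θ t))
    (hxα : x = R * Real.cos α) (hyα : y = R * Real.sin α)
    (hcost : cost φ ψ κ u T ≤ R + C) :
    IntegrableOn (excess φ ψ θ κ u α) (Icc 0 T) ∧
      ∫ t in (0:ℝ)..T, excess φ ψ θ κ u α t ≤ C := by
  have iφ : IntegrableOn (fun t => φ (κ t)) (Icc 0 T) :=
    (hφ.comp_continuousOn hκ).integrableOn_Icc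
  have icα : IntegrableOn (fun t => Real.cos (θ t - α)) (Icc 0 T) :=
    (Real.continuous_cos.comp_continuousOn (hθ.sub continuousOn_const)).integrableOn_Icc
  have ic : IntegrableOn (fun t => Real.cos (θ t)) (Icc 0 T) :=
    (Real.continuous_cos.comp_continuousOn hθ).integrableOn_Icc
  have is : IntegrableOn (fun t => Real.sin (θ t)) (Icc 0 T) :=
    (Real.continuous_sin.comp_continuousOn hθ).integrableOn_Icc
  have i1 : IntegrableOn (fun _ => (1:ℝ)) (Icc 0 T) := integrableOn_const (by simp)
  have iL : IntegrableOn (fun t => 1 + φ (κ t) + ψ (u t)) (Icc 0 T) := (i1.add iφ).add hψ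
  have e : excess φ ψ θ κ u α = fun t => (1 + φ (κ t) + ψ (u t)) - Real.cos (θ t - α) := by
    funext t
    simp only [excess]
    ring
  have m0 : (0:ℝ) ∈ Icc 0 T := ⟨le_rfl, hT.le⟩
  have mT : T ∈ Icc 0 T := ⟨hT.le, le_rfl⟩
  rw [e]
  refine ⟨iL.sub icα, ?_⟩
  rw [intervalIntegral.integral_sub (intervalIntegrable_of_mem iL m0 mT)
    (intervalIntegrable_of_mem icα m0 mT)]
  have hR : ∫ t in (0:ℝ)..T, Real.cos (θ t - α) = R := by
    simp only [Real.cos_sub]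
    rw [intervalIntegral.integral_add ((intervalIntegrable_of_mem ic m0 mT).mul_const _)
      ((intervalIntegrable_of_mem is m0 mT).mul_const _),
      intervalIntegral.integral_mul_const, intervalIntegral.integral_mul_const, ← hx, ← hy,
      hxα, hyα]
    linear_combination R * Real.sin_sq_add_cos_sq α
  rw [hR]
  simp only [cost] at hcost
  linarith

lemma one_le_add_of_window {φ ψ θ κ u p₃ p₄ : ℝ → ℝ} {T ρ φh α d K ε w : ℝ}
    (hφ : ContDiff ℝ 2 φ) (hφnn : ∀ r, 0 ≤ φ r) (hψnn : ∀ r, 0 ≤ ψ r)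
    (hφ' : ∀ r, |r| ≤ 32 * d → |deriv φ r| ≤ 1) (hψ' : ∀ r, |r| ≤ 2 * d → |deriv ψ r| ≤ 1)
    (hd : 0 < d) (hK : 0 ≤ K) (habs : ∀ r, |r| ≤ d + K * ψ r) (hKε : K * ε ≤ d)
    (hε2 : 2 * ε ≤ d ^ 2) (hε : ε ≤ 1 / 2)
    (hw : 0 ≤ w) (hwT : w + 3 ≤ T)
    (iu : IntegrableOn u (Icc 0 T))
    (hg : IntegrableOn (excess φ ψ θ κ u α) (Icc 0 T))
    (hgε : ∫ t in w..(w + 3), excess φ ψ θ κ u α t ≤ ε)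
    (cκ : ContinuousOn κ (Icc 0 T)) (cθ : ContinuousOn θ (Icc 0 T))
    (hθ : ∀ t ∈ Icc (0:ℝ) T, θ t = θ 0 + ∫ s in (0:ℝ)..t, κ s)
    (hκ : ∀ t ∈ Icc (0:ℝ) T, κ t = κ 0 + ∫ s in (0:ℝ)..t, u s)
    (hρ : ρ ≤ 1) (hpmp : PMPData φ ψ θ κ u T ρ φh p₃ p₄) :
    1 ≤ ρ + 170 * d := by
  obtain ⟨hρ0, -, hp3, hp4, hmax, hham⟩ := hpmp
  have gnn : ∀ t, 0 ≤ excess φ ψ θ κ u α t := fun t => by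
    have := Real.cos_le_one (θ t - α)
    have := hφnn (κ t)
    have := hψnn (u t)
    simp only [excess]
    linarith
  have hT : 0 ≤ T := by linarith
  have isin : IntegrableOn (fun t => ρ * Real.sin (θ t - φh)) (Icc 0 T) :=
    (continuousOn_const.mul (Real.continuous_sin.comp_continuousOn
      (cθ.sub continuousOn_const))).integrableOn_Icc
  have cp3 := continuousOn_of_primitive hT isin hp3
  have cφ' : ContinuousOn (fun t => deriv φ (κ t)) (Icc 0 T) :=
    hφ.deriv_one.continuous.comp_continuousOn cκ
  have gint : ∀ a b, w ≤ a → a ≤ b → b ≤ w + 3 →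
      ∫ t in a..b, excess φ ψ θ κ u α t ≤ ε := fun a b ha hab hb =>
    (intervalIntegral.integral_mono_interval ha hab hb (ae_of_all _ gnn)
      (intervalIntegrable_of_mem hg ⟨hw, by linarith⟩ ⟨by linarith, hwT⟩)).trans hgε
  obtain ⟨a, ha, hga, hmaxa, hhama⟩ := exists_good_time hg (hmax.and hham) hw (by linarith)
    (gint w (w + 1) le_rfl (by linarith) (by linarith))
  obtain ⟨b, hb, hgb, hmaxb⟩ := exists_good_time (a := w + 2) hg hmax (by linarith)
    (by linarith) (gint (w + 2) (w + 2 + 1) (by linarith) (by linarith) (by linarith))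
  have hab : a + 1 ≤ b := by linarith [ha.2, hb.1]
  have hba : b ≤ a + 3 := by linarith [ha.1, hb.2]
  have ma : a ∈ Icc 0 T := ⟨by linarith [ha.1], by linarith [ha.2]⟩
  have mb : b ∈ Icc 0 T := ⟨by linarith [hb.1], by linarith [hb.2]⟩
  have msub : Icc a b ⊆ Icc 0 T := Icc_subset_Icc ma.1 mb.2
  have point : ∀ t, excess φ ψ θ κ u α t ≤ ε → |u t| ≤ 2 * d ∧ |Real.sin (θ t - α)| ≤ d := by
    intro t ht
    have h1 := hφnn (κ t)
    have h2 := hψnn (u t)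
    have h3 := Real.cos_le_one (θ t - α)
    simp only [excess] at ht
    refine ⟨?_, abs_sin_le_of_one_sub_cos_le hd.le (by linarith) hε2⟩
    have := habs (u t)
    have : K * ψ (u t) ≤ K * ε := mul_le_mul_of_nonneg_left (by linarith) hK
    linarith
  obtain ⟨hua, hsa⟩ := point a hga
  obtain ⟨hub, hsb⟩ := point b hgb
  have hp4a : |p₄ a| ≤ 1 := hmaxa ▸ hψ' _ hua
  have hp4b : |p₄ b| ≤ 1 := hmaxb ▸ hψ' _ hub
  have hvar : ∀ t ∈ Icc a b, |κ t - κ a| ≤ 4 * d := by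
    intro t ht
    have mt := msub ht
    rw [sub_eq_integral_of_primitive iu hκ ma mt]
    calc |∫ s in a..t, u s| ≤ ∫ s in a..t, |u s| :=
          intervalIntegral.abs_integral_le_integral_abs ht.1
      _ ≤ ∫ s in a..t, (d + K * excess φ ψ θ κ u α s) := by
          refine intervalIntegral.integral_mono_on ht.1
            (intervalIntegrable_of_mem iu ma mt).abs
            ((by simp : IntervalIntegrable (fun _ => d) volume a t).add
              ((intervalIntegrable_of_mem hg ma mt).const_mul K)) fun s _ => ?_
          refine (habs (u s)).trans ?_
          have : ψ (u s) ≤ excess φ ψ θ κ u α s := by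
            have := Real.cos_le_one (θ s - α)
            have := hφnn (κ s)
            simp only [excess]
            linarith
          gcongr
      _ = (t - a) * d + K * ∫ s in a..t, excess φ ψ θ κ u α s := by
          rw [intervalIntegral.integral_add (by simp)
            ((intervalIntegrable_of_mem hg ma mt).const_mul K),
            intervalIntegral.integral_const_mul]
          simp
      _ ≤ 3 * d + K * ε := by
          have := gint a t ha.1 ht.1 (by linarith [ht.2, hb.2])
          have : t - a ≤ 3 := by linarith [ht.2]
          gcongr
      _ ≤ 4 * d := by linarith
  have hκa : |κ a| ≤ 28 * d := by
    refine abs_curvature_le hab hba hε (cθ.mono msub) (cκ.mono msub)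
      (fun t ht => hasDerivAt_of_primitive cκ hθ
        ⟨ma.1.trans_lt ht.1, ht.2.trans_le mb.2⟩) hvar hsa hsb ?_
    refine le_trans (intervalIntegral.integral_mono_on (by linarith) ?_
      (intervalIntegrable_of_mem hg ma mb) fun t _ => ?_)
      (gint a b ha.1 (by linarith) (by linarith [hb.2]))
    · exact (continuousOn_const.sub (Real.continuous_cos.comp_continuousOn
        ((cθ.mono msub).sub continuousOn_const))).intervalIntegrable_of_Icc (by linarith)
    · have := hφnn (κ t)
      have := hψnn (u t)
      simp only [excess]
      linarith
  have hκt : ∀ t ∈ Icc a b, |κ t| ≤ 32 * d := by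
    intro t ht
    have h1 := hvar t ht
    rw [abs_le] at *
    constructor <;> linarith [h1.1, h1.2, hκa.1, hκa.2]
  have hp3a : |p₃ a| ≤ 6 := by
    refine abs_le_of_abs_integral_le hab (cp3.mono msub) (fun t ht => ?_) ?_
    · rw [sub_eq_integral_of_primitive isin hp3 ma (msub ht)]
      have := intervalIntegral.norm_integral_le_of_norm_le_const (a := a) (b := t) (C := 1)
        (f := fun s => ρ * Real.sin (θ s - φh)) (fun s _ => ?_)
      · rw [Real.norm_eq_abs, one_mul, abs_of_nonneg (by linarith [ht.1] : 0 ≤ t - a)] at this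
        linarith [ht.2]
      · rw [Real.norm_eq_abs, abs_mul, abs_of_pos hρ0]
        exact mul_le_one₀ hρ (abs_nonneg _) (Real.abs_sin_le_one _)
    · have i3 : IntervalIntegrable p₃ volume a b :=
        intervalIntegrable_of_mem cp3.integrableOn_Icc ma mb
      have iφ' : IntervalIntegrable (fun t => deriv φ (κ t)) volume a b :=
        intervalIntegrable_of_mem cφ'.integrableOn_Icc ma mb
      have h4 := sub_eq_integral_of_primitive (cp3.neg.add cφ').integrableOn_Icc hp4 ma mb
      simp only [Pi.add_apply, Pi.neg_apply] at h4
      have i3n : IntervalIntegrable (fun t => -p₃ t) volume a b := i3.neg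
      rw [intervalIntegral.integral_add i3n iφ', intervalIntegral.integral_neg] at h4
      have h5 := intervalIntegral.norm_integral_le_of_norm_le_const (a := a) (b := b) (C := 1)
        (f := fun s => deriv φ (κ s)) (fun s hs => by
          rw [uIoc_of_le (by linarith)] at hs
          exact hφ' _ (hκt s (Ioc_subset_Icc_self hs)))
      rw [Real.norm_eq_abs, one_mul, abs_of_nonneg (by linarith : 0 ≤ b - a)] at h5
      rw [abs_le] at *
      constructor <;> linarith [h5.1, h5.2, hp4a.1, hp4a.2, hp4b.1, hp4b.2]
  have t1 : ρ * Real.cos (θ a - φh) ≤ ρ := by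
    nlinarith [Real.cos_le_one (θ a - φh)]
  have t2 : p₃ a * κ a ≤ 6 * (28 * d) := by
    refine (le_abs_self _).trans ?_
    rw [abs_mul]
    gcongr
  have t3 : p₄ a * u a ≤ 1 * (2 * d) := by
    refine (le_abs_self _).trans ?_
    rw [abs_mul]
    gcongr
  linarith [hφnn (κ a), hψnn (u a)]

/-- `ρ ≥ 1 - ν` for optimal trajectories with large final time. -/
theorem rho_lower_bound
    (φ ψ : ℝ → ℝ) (p C₀ R₀ : ℝ)
    (h1 : H1 φ ψ) (h2 : H2 ψ) (h3 : H3 ψ p C₀ R₀)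
    (ν : ℝ) (hν : 0 < ν) :
    ∃ T₀ > (0:ℝ),
      ∀ (x₁ y₁ θ₁ : ℝ), 8 * Real.sqrt π ≤ Real.sqrt (x₁^2 + y₁^2) →
      ∀ (x y θ κ u : ℝ → ℝ) (T ρ φh : ℝ) (p₃ p₄ : ℝ → ℝ),
        T₀ ≤ T →
        IsOptimal φ ψ p x y θ κ u T Xinit (x₁, y₁, θ₁, 0) →
        PMPData φ ψ θ κ u T ρ φh p₃ p₄ →
        1 - ν ≤ ρ := by
  obtain ⟨hφnn, hψnn, hφc, hψc, -, hψe, -, -, hφ0, hψ0⟩ := h1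
  obtain ⟨hconv, -⟩ := h2
  have hp : 1 < p := h3.1
  have hcv := hconv.convexOn
  obtain ⟨C, hC⟩ := anglePath_exists hφc.continuous hψc.continuous hφ0 hψ0
  obtain ⟨η₁, hη₁, hφ'⟩ := exists_abs_deriv_le_one hφc hφnn hφ0
  obtain ⟨η₂, hη₂, hψ'⟩ := exists_abs_deriv_le_one hψc hψnn hψ0
  set d := min (ν / 170) (min (η₁ / 32) (η₂ / 2)) with hd_def
  have hd : 0 < d := by positivity
  have hdν : d ≤ ν / 170 := min_le_left _ _
  have hd1 : d ≤ η₁ / 32 := (min_le_right _ _).trans (min_le_left _ _)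
  have hd2 : d ≤ η₂ / 2 := (min_le_right _ _).trans (min_le_right _ _)
  have hψd : 0 < ψ d := hconv.pos_of_nonneg hψnn hψ0 hd.ne'
  set ε := min (1 / 2) (min (d ^ 2 / 2) (ψ d)) with hε_def
  have hε : 0 < ε := by positivity
  have hε1 : ε ≤ 1 / 2 := min_le_left _ _
  have hε2 : ε ≤ d ^ 2 / 2 := (min_le_right _ _).trans (min_le_left _ _)
  have hε3 : ε ≤ ψ d := (min_le_right _ _).trans (min_le_right _ _)
  have hKε : d / ψ d * ε ≤ d := by
    rw [div_mul_eq_mul_div, div_le_iff₀ hψd]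
    exact mul_le_mul_of_nonneg_left hε3 hd.le
  obtain ⟨N, hN⟩ := exists_nat_gt (C / ε)
  rw [div_lt_iff₀ hε] at hN
  refine ⟨3 * N + 1, by positivity, ?_⟩
  intro x₁ y₁ θ₁ _ x y θ κ u T ρ φh p₃ p₄ hT hopt hpmp
  rcases le_or_gt 1 ρ with hρ | hρ
  · linarith
  obtain ⟨⟨hT0, hum, hup, hx0, hy0, -, -, hx, hy, hθ, hκ, hxT, hyT, -, -⟩, hmin⟩ := hopt
  have iu := integrableOn_of_rpow hp hum hup
  have cκ := continuousOn_of_primitive hT0.le iu hκ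
  have cθ := continuousOn_of_primitive hT0.le cκ.integrableOn_Icc hθ
  have cp3 := continuousOn_of_primitive hT0.le
    (continuousOn_const.mul (Real.continuous_sin.comp_continuousOn
      (cθ.sub continuousOn_const))).integrableOn_Icc hpmp.2.2.1
  have cp4 := continuousOn_of_primitive hT0.le
    (cp3.neg.add (hφc.deriv_one.continuous.comp_continuousOn cκ)).integrableOn_Icc hpmp.2.2.2.1
  have iψ := integrableOn_comp_of_deriv_eq hcv hψc hψnn hψ0 hum iu cp4 hpmp.2.2.2.2.1
  obtain ⟨T', c, k, hT', hTc, hpath⟩ := hC x₁ y₁ θ₁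
  obtain ⟨x', y', θ', κ', u', hcon, hcost'⟩ := hpath.connects (p := p) (by linarith) hT' rfl
    hφc.continuous hψc.continuous
  have hcost := (hmin x' y' θ' κ' u' T' hcon).trans (hcost'.trans hTc)
  obtain ⟨α, -, hxα, hyα⟩ := exists_polar x₁ y₁
  have mT : T ∈ Icc 0 T := ⟨hT0.le, le_rfl⟩
  have hx1 : x₁ = ∫ t in (0:ℝ)..T, Real.cos (θ t) := by
    have := hx T mT
    rw [hx0, hxT] at this
    simpa [Xinit] using this
  have hy1 : y₁ = ∫ t in (0:ℝ)..T, Real.sin (θ t) := by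
    have := hy T mT
    rw [hy0, hyT] at this
    simpa [Xinit] using this
  obtain ⟨hg, hgC⟩ := integral_excess_le hT0 hφc.continuous cκ cθ iψ hx1 hy1 hxα hyα hcost
  have gnn : ∀ t, 0 ≤ excess φ ψ θ κ u α t := fun t => by
    have := Real.cos_le_one (θ t - α)
    have := hφnn (κ t)
    have := hψnn (u t)
    simp only [excess]
    linarith
  obtain ⟨w, hw, hwT, hgw⟩ := exists_window hg gnn hgC hN (by linarith)
  have := one_le_add_of_window hφc hφnn hψnn (fun r hr => hφ' r (by linarith))
    (fun r hr => hψ' r (by linarith)) hd (div_pos hd hψd).le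
    (hcv.abs_le_add_mul hψnn hψe hψ0 hd hψd) hKε (by linarith) hε1 hw hwT iu hg hgw cκ cθ
    hθ hκ hρ.le hpmp
  linarith

end
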